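/- In the logic Int2GC, the Fischer Servi axiom schemes (FS2) and (FS3) are deductively equivalent: the smallest extension of Int2GC containing all instances of (FS2) ◇(A → B) → (□A → ◇B) and the smallest extension of Int2GC containing all instances of (FS3) (◆A → ■B) → ■(A → B) prove exactly the same formulas. -/

import Mathlib

/-- Formulas of the modal language with four unary modalities:
`dia1` = ◆, `box1` = □, `dia2` = ◇, `box2` = ■. -/
inductive Fm : Type
  | var : ℕ → Fm
  | and : Fm → Fm → Fm
  | or  : Fm → Fm → Fm
  | imp : Fm → Fm → Fm
  | neg : Fm → Fm
  | dia1 : Fm → Fm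
  | box1 : Fm → Fm
  | dia2 : Fm → Fm
  | box2 : Fm → Fm

/-- Instances of the axiom schemes of intuitionistic propositional logic. -/
inductive IntAx : Fm → Prop
  | a1 (A B : Fm) : IntAx (.imp A (.imp B A))
  | a2 (A B C : Fm) : IntAx (.imp (.imp A (.imp B C)) (.imp (.imp A B) (.imp A C)))
  | a3 (A B : Fm) : IntAx (.imp (.and A B) A)
  | a4 (A B : Fm) : IntAx (.imp (.and A B) B)
  | a5 (A B : Fm) : IntAx (.imp A (.imp B (.and A B)))
  | a6 (A B : Fm) : IntAx (.imp A (.or A B))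
  | a7 (A B : Fm) : IntAx (.imp B (.or A B))
  | a8 (A B C : Fm) : IntAx (.imp (.imp A C) (.imp (.imp B C) (.imp (.or A B) C)))
  | a9 (A B : Fm) : IntAx (.imp (.imp A B) (.imp (.imp A (.neg B)) (.neg A)))
  | a10 (A B : Fm) : IntAx (.imp (.neg A) (.imp A B))

/-- Provability in the extension of Int2GC by the extra axiom scheme `Ax`:
the smallest set of formulas containing all intuitionistic axiom instances and all
instances of `Ax`, closed under modus ponens and the four Galois-connection rules. -/
inductive Prov (Ax : Fm → Prop) : Fm → Prop
  | intAx {A : Fm} : IntAx A → Prov Ax A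
  | extra {A : Fm} : Ax A → Prov Ax A
  | mp {A B : Fm} : Prov Ax (.imp A B) → Prov Ax A → Prov Ax B
  | gc1 {A B : Fm} : Prov Ax (.imp A (.box1 B)) → Prov Ax (.imp (.dia1 A) B)
  | gc2 {A B : Fm} : Prov Ax (.imp (.dia1 A) B) → Prov Ax (.imp A (.box1 B))
  | gc3 {A B : Fm} : Prov Ax (.imp A (.box2 B)) → Prov Ax (.imp (.dia2 A) B)
  | gc4 {A B : Fm} : Prov Ax (.imp (.dia2 A) B) → Prov Ax (.imp A (.box2 B))

/-- The empty extra axiom scheme: `Prov NoAx` is provability in Int2GC itself. -/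
def NoAx : Fm → Prop := fun _ => False

/-- Instances of (FS1): ◆(A → B) → (■A → ◆B). -/
def FS1Ax (C : Fm) : Prop := ∃ A B : Fm, C = .imp (.dia1 (.imp A B)) (.imp (.box2 A) (.dia1 B))
/-- Instances of (FS2): ◇(A → B) → (□A → ◇B). -/
def FS2Ax (C : Fm) : Prop := ∃ A B : Fm, C = .imp (.dia2 (.imp A B)) (.imp (.box1 A) (.dia2 B))
/-- Instances of (FS3): (◆A → ■B) → ■(A → B). -/
def FS3Ax (C : Fm) : Prop := ∃ A B : Fm, C = .imp (.imp (.dia1 A) (.box2 B)) (.box2 (.imp A B))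
/-- Instances of (FS4): (◇A → □B) → □(A → B). -/
def FS4Ax (C : Fm) : Prop := ∃ A B : Fm, C = .imp (.imp (.dia2 A) (.box1 B)) (.box1 (.imp A B))
/-- The Fischer Servi scheme (FS1)+(FS2); `Prov FSAx` is provability in Int2GC+FS. -/
def FSAx (C : Fm) : Prop := FS1Ax C ∨ FS2Ax C

namespace Prov

variable {Ax Ax' : Fm → Prop} {A A' B B' C : Fm}

theorem imp_self (A : Fm) : Prov Ax (.imp A A) :=
  .mp (.mp (.intAx (.a2 A (.imp A A) A)) (.intAx (.a1 A (.imp A A)))) (.intAx (.a1 A A))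

theorem imp_imp_of_imp_right (A : Fm) (h : Prov Ax (.imp B B')) :
    Prov Ax (.imp (.imp A B) (.imp A B')) :=
  .mp (.intAx (.a2 A B B')) (.mp (.intAx (.a1 _ A)) h)

theorem imp_trans (h₁ : Prov Ax (.imp A B)) (h₂ : Prov Ax (.imp B C)) : Prov Ax (.imp A C) :=
  .mp (imp_imp_of_imp_right A h₂) h₁

theorem imp_imp_of_imp_left (B : Fm) (h : Prov Ax (.imp A' A)) :
    Prov Ax (.imp (.imp A B) (.imp A' B)) :=
  .mp (.mp (.intAx (.a2 _ _ _)) (imp_trans (.intAx (.a1 _ A')) (.intAx (.a2 A' A B))))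
    (.mp (.intAx (.a1 _ _)) h)

theorem imp_imp_imp (h₁ : Prov Ax (.imp A' A)) (h₂ : Prov Ax (.imp B B')) :
    Prov Ax (.imp (.imp A B) (.imp A' B')) :=
  imp_trans (imp_imp_of_imp_left B h₁) (imp_imp_of_imp_right A' h₂)

/-- An extension that proves every instance of a scheme contains the extension by that scheme. -/
theorem of_forall_extra (h : ∀ A, Ax A → Prov Ax' A) (hC : Prov Ax C) : Prov Ax' C := by
  induction hC with
  | intAx h => exact .intAx h
  | extra hA => exact h _ hA
  | mp _ _ ih₁ ih₂ => exact .mp ih₁ ih₂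
  | gc1 _ ih => exact .gc1 ih
  | gc2 _ ih => exact .gc2 ih
  | gc3 _ ih => exact .gc3 ih
  | gc4 _ ih => exact .gc4 ih

theorem fs3_of_fs2 (hC : FS3Ax C) : Prov FS2Ax C := by
  obtain ⟨A, B, rfl⟩ := hC
  exact .gc4 (imp_trans (.extra ⟨_, _, rfl⟩)
    (imp_imp_imp (.gc2 (imp_self (.dia1 A))) (.gc3 (imp_self (.box2 B)))))

theorem fs2_of_fs3 (hC : FS2Ax C) : Prov FS3Ax C := by
  obtain ⟨A, B, rfl⟩ := hC
  exact .gc3 (imp_trans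
    (imp_imp_imp (.gc1 (imp_self (.box1 A))) (.gc4 (imp_self (.dia2 B))))
    (.extra ⟨_, _, rfl⟩))

end Prov

/-- In Int2GC, the Fischer Servi axiom schemes (FS2) and (FS3) are deductively
equivalent: their extensions of Int2GC prove exactly the same formulas. -/
theorem FS2_equiv_FS3 : ∀ C : Fm, Prov FS2Ax C ↔ Prov FS3Ax C := by
  exact fun _ => ⟨Prov.of_forall_extra fun _ => Prov.fs2_of_fs3,
    Prov.of_forall_extra fun _ => Prov.fs3_of_fs2⟩
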